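/- Assume the additive model Y = h(Xⱼ) + H(X₋ⱼ) + ε with h(x) = a₀ + Σ_{l=1}^{m₁} a_l x^l, Σ_{l=1}^{m₁}|a_l| > 0, E|H(X₋ⱼ)| < ∞, ε integrable with mean zero and independent of X, and X uniformly distributed on [0,1]^p; let g^{(l)}(x) = x^l for l = 1, …, m₁. Then there exists a constant c_{m₁} > 0 depending only on m₁ such that min{Σ_{l=1}^{m₁}|κⱼ^{(l)}|, Σ_{l=1}^{m₁}|κ_{j|X₋ⱼ}^{(l)}|} ≥ (Σ_{l=1}^{m₁}|a_l| / m₁)·c_{m₁} > 0. In particular, for m₁ ∈ {1, 2}, min{Σ_{l}|κⱼ^{(l)}|, Σ_{l}|κ_{j|X₋ⱼ}^{(l)}|} ≥ 0.001·Σ_{l}|a_l|. -/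

import Mathlib

open MeasureTheory ProbabilityTheory


/-- The conclusion of Proposition 2, for a polynomial degree `m₁` and a lower bound
`bound(Σ_l |a_l|)`: for every probability space, every uniformly distributed feature vector
`X` on `[0,1]^p`, every additive model `Y = a₀ + Σ_{l=1}^{m₁} a_l Xⱼ^l + H(X₋ⱼ) + ε` with
`Σ_l |a_l| > 0`, one has
`bound(Σ_l |a_l|) ≤ min{Σ_l |κⱼ⁽ˡ⁾|, Σ_l |κ_{j|X₋ⱼ}⁽ˡ⁾|}`, where `g⁽ˡ⁾(x) = x^l`. -/
def Prop2Conclusion (m₁ : ℕ) (bound : ℝ → ℝ) : Prop :=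
  ∀ (Ω : Type) [MeasurableSpace Ω] (μ : Measure Ω) [IsProbabilityMeasure μ]
    (p : ℕ) (j : Fin p) (X : Ω → Fin p → ℝ),
    Measurable X →
    -- X is uniformly distributed on [0,1]^p
    Measure.map X μ = Measure.pi (fun _ : Fin p => volume.restrict (Set.Icc (0 : ℝ) 1)) →
    ∀ (a : ℕ → ℝ),
    0 < ∑ l ∈ Finset.Icc 1 m₁, |a l| →
    ∀ (H : ({k : Fin p // k ≠ j} → ℝ) → ℝ), Measurable H →
    Integrable (fun ω => H (fun k => X ω k.1)) μ →
    ∀ (ε : Ω → ℝ), Measurable ε → Integrable ε μ → (∫ ω, ε ω ∂μ) = 0 →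
    IndepFun ε X μ →
    ∀ (Y : Ω → ℝ),
    (∀ ω, Y ω = (a 0 + ∑ l ∈ Finset.Icc 1 m₁, a l * (X ω j) ^ l)
        + H (fun k => X ω k.1) + ε ω) →
    bound (∑ l ∈ Finset.Icc 1 m₁, |a l|) ≤
      min
        (∑ l ∈ Finset.Icc 1 m₁,
          |∫ ω, (Y ω
              - (μ[Y | MeasurableSpace.comap
                  (fun ω' (k : {k : Fin p // k ≠ j}) => X ω' k.1) inferInstance]) ω)
            * ((X ω j) ^ l - ∫ ω', (X ω' j) ^ l ∂μ) ∂μ|)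
        (∑ l ∈ Finset.Icc 1 m₁,
          |∫ ω, (Y ω
              - (μ[Y | MeasurableSpace.comap
                  (fun ω' (k : {k : Fin p // k ≠ j}) => X ω' k.1) inferInstance]) ω)
            * ((X ω j) ^ l
              - (μ[fun ω' => (X ω' j) ^ l | MeasurableSpace.comap
                  (fun ω' (k : {k : Fin p // k ≠ j}) => X ω' k.1) inferInstance]) ω) ∂μ|)


noncomputable def covM (k l : ℕ) : ℝ := 1/((k:ℝ)+l+1) - 1/(((k:ℝ)+1)*((l:ℝ)+1))

lemma integral_covM (k l : ℕ) :
    ∫ x in (0:ℝ)..1, (x^k - 1/((k:ℝ)+1)) * (x^l - 1/((l:ℝ)+1)) = covM k l := by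
  have : ∀ x : ℝ, (x^k - 1/((k:ℝ)+1)) * (x^l - 1/((l:ℝ)+1)) =
      x^(k+l) - (1/((l:ℝ)+1)) * x^k - (1/((k:ℝ)+1)) * x^l + 1/((k:ℝ)+1) * (1/((l:ℝ)+1)) := by
    intro x; ring
  simp_rw [this]
  have hi : ∀ f : ℝ → ℝ, Continuous f → IntervalIntegrable f volume 0 1 :=
    fun f hf => hf.intervalIntegrable _ _
  rw [intervalIntegral.integral_add (hi _ (by fun_prop)) (hi _ (by fun_prop)),
    intervalIntegral.integral_sub (hi _ (by fun_prop)) (hi _ (by fun_prop)),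
    intervalIntegral.integral_sub (hi _ (by fun_prop)) (hi _ (by fun_prop))]
  simp only [intervalIntegral.integral_const_mul, integral_pow, intervalIntegral.integral_const]
  have h1 : (k:ℝ)+1 ≠ 0 := by positivity
  have h2 : (l:ℝ)+1 ≠ 0 := by positivity
  have h3 : (k:ℝ)+l+1 ≠ 0 := by positivity
  simp [covM]

lemma covM_inj (m : ℕ) (a : ℕ → ℝ)
    (h : ∀ l ∈ Finset.Icc 1 m, ∑ k ∈ Finset.Icc 1 m, a k * covM k l = 0) :
    ∀ l ∈ Finset.Icc 1 m, a l = 0 := by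
  classical
  let P : Polynomial ℝ := ∑ k ∈ Finset.Icc 1 m,
    Polynomial.C (a k) * (Polynomial.X ^ k - Polynomial.C (1/((k:ℝ)+1)))
  have hP : ∀ x, P.eval x = ∑ k ∈ Finset.Icc 1 m, a k * (x^k - 1/((k:ℝ)+1)) := by
    intro x; simp only [P, Polynomial.eval_finsetSum, Polynomial.eval_mul, Polynomial.eval_C,
      Polynomial.eval_sub, Polynomial.eval_pow, Polynomial.eval_X]
  have h0 : ∫ x in (0:ℝ)..1, (P.eval x)^2 = 0 := by
    have : ∀ x, (P.eval x)^2 = ∑ l ∈ Finset.Icc 1 m, ∑ k ∈ Finset.Icc 1 m,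
        (a l * a k) * ((x^k - 1/((k:ℝ)+1)) * (x^l - 1/((l:ℝ)+1))) := by
      intro x
      rw [hP, sq, Finset.sum_mul_sum]
      refine Finset.sum_congr rfl fun l _ => Finset.sum_congr rfl fun k _ => by ring
    simp_rw [this]
    rw [intervalIntegral.integral_finsetSum]
    · refine Finset.sum_eq_zero fun l hl => ?_
      rw [intervalIntegral.integral_finsetSum]
      · simp_rw [intervalIntegral.integral_const_mul, integral_covM, mul_assoc]
        rw [← Finset.mul_sum, h l hl, mul_zero]
      · intro k _
        exact Continuous.intervalIntegrable (by fun_prop) _ _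
    · intro k _
      exact Continuous.intervalIntegrable (by fun_prop) _ _
  have hz : ∀ x ∈ Set.Icc (0:ℝ) 1, P.eval x = 0 := by
    intro x hx
    by_contra hne
    have := intervalIntegral.integral_pos (a := 0) (b := 1) (f := fun x => (P.eval x)^2) one_pos
      (by fun_prop) (fun x _ => sq_nonneg _) ⟨x, hx, by positivity⟩
    linarith
  have hP0 : P = 0 := Polynomial.eq_zero_of_infinite_isRoot P
    ((Set.Icc_infinite (one_pos : (0:ℝ) < 1)).mono hz)
  intro l hl
  have hc : P.coeff l = a l := by
    simp only [P, Polynomial.finsetSum_coeff, Polynomial.coeff_C_mul, Polynomial.coeff_sub,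
      Polynomial.coeff_X_pow, Polynomial.coeff_C]
    have : l ≠ 0 := by have := Finset.mem_Icc.1 hl; omega
    simp only [this, if_false, sub_zero, mul_ite, mul_one, mul_zero]
    rw [Finset.sum_ite_eq]
    simp only [hl, if_true]
  rw [← hc, hP0, Polynomial.coeff_zero]

lemma covM_bound (m : ℕ) (hm : 1 ≤ m) : ∃ c : ℝ, 0 < c ∧ ∀ a : ℕ → ℝ,
    (∑ l ∈ Finset.Icc 1 m, |a l|) / m * c ≤
      ∑ l ∈ Finset.Icc 1 m, |∑ k ∈ Finset.Icc 1 m, a k * covM k l| := by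
  classical
  let L : ({l // l ∈ Finset.Icc 1 m} → ℝ) →ₗ[ℝ] ({l // l ∈ Finset.Icc 1 m} → ℝ) := (Matrix.of fun (l k : {l // l ∈ Finset.Icc 1 m}) => covM k l).mulVecLin
  have hL : ∀ v l, L v l = ∑ k : {l // l ∈ Finset.Icc 1 m}, v k * covM k l := by
    intro v l
    simp only [L, Matrix.mulVecLin_apply, Matrix.mulVec, dotProduct, Matrix.of_apply]
    exact Finset.sum_congr rfl fun _ _ => mul_comm _ _
  have hker : LinearMap.ker L = ⊥ := by
    rw [LinearMap.ker_eq_bot']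
    intro v hv
    have := covM_inj m (fun k => if h : k ∈ Finset.Icc 1 m then v ⟨k, h⟩ else 0) (by
      intro l hl
      have := congrFun hv ⟨l, hl⟩
      rw [hL] at this
      rw [← Finset.sum_coe_sort]
      refine Eq.trans (Finset.sum_congr rfl fun k _ => ?_) this
      simp only [Subtype.coe_eta, k.2, dif_pos])
    funext l
    have := this l l.2
    simpa only [Subtype.coe_eta, l.2, dif_pos, Pi.zero_apply] using this
  obtain ⟨K, hK, hA⟩ := L.exists_antilipschitzWith hker
  refine ⟨1/K, by positivity, fun a => ?_⟩
  let v : {l // l ∈ Finset.Icc 1 m} → ℝ := fun k => a k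
  have h1 : ‖v‖ ≤ K * ‖L v‖ := by
    have := hA.le_mul_dist v 0
    simpa [dist_zero_right] using this
  have h2 : ‖L v‖ ≤ ∑ l ∈ Finset.Icc 1 m, |∑ k ∈ Finset.Icc 1 m, a k * covM k l| := by
    rw [pi_norm_le_iff_of_nonneg (Finset.sum_nonneg fun _ _ => abs_nonneg _)]
    intro l
    rw [hL, Real.norm_eq_abs, Finset.sum_coe_sort (Finset.Icc 1 m) (fun k => a k * covM k l)]
    exact Finset.single_le_sum
      (f := fun l : ℕ => |∑ k ∈ Finset.Icc 1 m, a k * covM k l|)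
      (fun _ _ => abs_nonneg _) l.2
  have h3 : ∑ l ∈ Finset.Icc 1 m, |a l| ≤ m * ‖v‖ := by
    have : ∑ l ∈ Finset.Icc 1 m, |a l| ≤ ∑ l ∈ Finset.Icc 1 m, ‖v‖ :=
      Finset.sum_le_sum fun l hl => norm_le_pi_norm v ⟨l, hl⟩
    simpa using this
  have hm' : (0:ℝ) < m := by exact_mod_cast hm
  have hK' : (0:ℝ) < K := hK
  rw [div_mul_div_comm, mul_one, div_le_iff₀ (by positivity)]
  calc _ ≤ m * ‖v‖ := h3
    _ ≤ m * (K * ‖L v‖) := by gcongr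
    _ ≤ m * (K * ∑ l ∈ Finset.Icc 1 m, |∑ k ∈ Finset.Icc 1 m, a k * covM k l|) := by gcongr
    _ = _ := by ring

lemma covM_small (m : ℕ) (hm : 1 ≤ m) (hm2 : m ≤ 2) (a : ℕ → ℝ) :
    0.001 * (∑ l ∈ Finset.Icc 1 m, |a l|) ≤
      ∑ l ∈ Finset.Icc 1 m, |∑ k ∈ Finset.Icc 1 m, a k * covM k l| := by
  interval_cases m
  · simp [covM, abs_mul]
    norm_num [abs_of_pos]
    nlinarith [abs_nonneg (a 1)]
  · have : Finset.Icc 1 2 = {1, 2} := rfl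
    simp [this, covM]
    norm_num
    cases abs_cases (a 1) <;> cases abs_cases (a 2) <;>
    cases abs_cases (a 1 * (1/12) + a 2 * (1/12)) <;>
    cases abs_cases (a 1 * (1/12) + a 2 * (4/45)) <;> linarith

lemma kappa_eq {Ω : Type} [mΩ : MeasurableSpace Ω] (μ : Measure Ω) [IsProbabilityMeasure μ]
    (p : ℕ) (j : Fin p) (X : Ω → Fin p → ℝ) (hX : Measurable X)
    (hmap : Measure.map X μ = Measure.pi (fun _ : Fin p => volume.restrict (Set.Icc (0 : ℝ) 1)))
    (m₁ : ℕ) (a : ℕ → ℝ)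
    (H : ({k : Fin p // k ≠ j} → ℝ) → ℝ) (hH : Measurable H)
    (hHi : Integrable (fun ω => H (fun k => X ω k.1)) μ)
    (ε : Ω → ℝ) (hε : Measurable ε) (hεi : Integrable ε μ) (hε0 : (∫ ω, ε ω ∂μ) = 0)
    (hind : IndepFun ε X μ) (Y : Ω → ℝ)
    (hY : ∀ ω, Y ω = (a 0 + ∑ l ∈ Finset.Icc 1 m₁, a l * (X ω j) ^ l)
        + H (fun k => X ω k.1) + ε ω) (l : ℕ) :
    (∫ ω, (Y ω
              - (μ[Y | MeasurableSpace.comap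
                  (fun ω' (k : {k : Fin p // k ≠ j}) => X ω' k.1) inferInstance]) ω)
            * ((X ω j) ^ l - ∫ ω', (X ω' j) ^ l ∂μ) ∂μ)
      = ∑ k ∈ Finset.Icc 1 m₁, a k * covM k l ∧
    (∫ ω, (Y ω
              - (μ[Y | MeasurableSpace.comap
                  (fun ω' (k : {k : Fin p // k ≠ j}) => X ω' k.1) inferInstance]) ω)
            * ((X ω j) ^ l
              - (μ[fun ω' => (X ω' j) ^ l | MeasurableSpace.comap
                  (fun ω' (k : {k : Fin p // k ≠ j}) => X ω' k.1) inferInstance]) ω) ∂μ)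
      = ∑ k ∈ Finset.Icc 1 m₁, a k * covM k l := by
  have hpr : IsProbabilityMeasure (volume.restrict (Set.Icc (0 : ℝ) 1)) :=
    ⟨by simp⟩
  have hXi : ∀ i, Measurable (fun ω => X ω i) := fun i => (measurable_pi_apply i).comp hX
  have hmapi : ∀ i, μ.map (fun ω => X ω i) = volume.restrict (Set.Icc (0 : ℝ) 1) := by
    intro i
    rw [← (measurePreserving_eval (fun _ : Fin p => volume.restrict (Set.Icc (0 : ℝ) 1)) i).map_eq,
      ← hmap, Measure.map_map (measurable_pi_apply i) hX]
    rfl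
  have hiI : iIndepFun (fun i ω => X ω i) μ := by
    rw [iIndepFun_iff_map_fun_eq_pi_map (fun i => (hXi i).aemeasurable)]
    simp_rw [hmapi]
    exact hmap
  set W : Ω → ({k : Fin p // k ≠ j} → ℝ) := fun ω' k => X ω' k.1 with hW
  have hWm : Measurable W := measurable_pi_lambda _ fun k => hXi k.1
  set U : Ω → ℝ := fun ω => X ω j with hU
  have hUm : Measurable U := hXi j
  have hUW : IndepFun U W μ := by
    have := hiI.indepFun_finset {j} (Finset.univ.erase j) (by simp) hXi
    have m1 : Measurable (fun v : (({j} : Finset (Fin p)) → ℝ) => v ⟨j, by simp⟩) :=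
      measurable_pi_apply _
    have m2 : Measurable (fun (v : ↥(Finset.univ.erase j) → ℝ)
        (k : {k : Fin p // k ≠ j}) => v ⟨k.1, by simp [k.2]⟩) :=
      measurable_pi_lambda _ fun k => measurable_pi_apply _
    exact this.comp m1 m2
  have m3 : Measurable (fun (v : Fin p → ℝ) (k : {k : Fin p // k ≠ j}) => v k.1) :=
    measurable_pi_lambda _ fun k => measurable_pi_apply _
  have m4 : Measurable (fun (v : Fin p → ℝ) => v j) := measurable_pi_apply _
  have hεW : IndepFun ε W μ := hind.comp measurable_id m3
  have hεU : IndepFun ε U μ := hind.comp measurable_id m4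
  have hfi : ∀ f : ℝ → ℝ, Continuous f → Integrable (fun ω => f (U ω)) μ := by
    intro f hf
    have : Integrable f (μ.map U) := by
      rw [hmapi j]
      exact hf.continuousOn.integrableOn_compact isCompact_Icc
    exact this.comp_measurable hUm
  have hfint : ∀ f : ℝ → ℝ, Continuous f → ∫ ω, f (U ω) ∂μ = ∫ x in (0:ℝ)..1, f x := by
    intro f hf
    rw [intervalIntegral.integral_of_le zero_le_one, ← integral_Icc_eq_integral_Ioc, ← hmapi j,
      integral_map hUm.aemeasurable hf.aestronglyMeasurable]
  have hmean : ∀ k : ℕ, ∫ ω, (U ω)^k ∂μ = 1/((k:ℝ)+1) := by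
    intro k
    rw [hfint (fun x => x^k) (by fun_prop)]
    simp
  set 𝓦 : MeasurableSpace Ω := MeasurableSpace.comap W inferInstance with h𝓦
  have hle : 𝓦 ≤ mΩ := hWm.comap_le
  have hcU : ∀ f : ℝ → ℝ, Continuous f →
      μ[fun ω => f (U ω) | 𝓦] =ᵐ[μ] fun _ => ∫ ω, f (U ω) ∂μ := by
    intro f hf
    refine condExp_indep_eq hUm.comap_le hle
      (hf.stronglyMeasurable.comp_measurable (comap_measurable U)) ?_
    exact (IndepFun_iff_Indep _ _ _).1 hUW
  have hcε : μ[ε | 𝓦] =ᵐ[μ] fun _ => 0 := by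
    have := condExp_indep_eq (μ := μ) hε.comap_le hle
      (comap_measurable ε).stronglyMeasurable ((IndepFun_iff_Indep _ _ _).1 hεW)
    rwa [hε0] at this
  have hcH : μ[fun ω => H (W ω) | 𝓦] = fun ω => H (W ω) :=
    condExp_of_stronglyMeasurable hle
      ((hH.comp (comap_measurable W)).stronglyMeasurable) hHi
  let h : ℝ → ℝ := fun x => a 0 + ∑ l ∈ Finset.Icc 1 m₁, a l * x ^ l
  have hh : Continuous h := by fun_prop
  have hYe : Y = (fun ω => h (U ω)) + (fun ω => H (W ω)) + ε := by
    funext ω; exact hY ω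
  have hcY : μ[Y | 𝓦] =ᵐ[μ] fun ω => (∫ ω, h (U ω) ∂μ) + H (W ω) := by
    rw [hYe]
    filter_upwards [condExp_add ((hfi h hh).add hHi) hεi 𝓦, condExp_add (hfi h hh) hHi 𝓦,
      hcε, hcU h hh] with ω h1 h2 h3 h4
    rw [h1, Pi.add_apply, h2, Pi.add_apply, h3, h4, hcH, add_zero]
  have hmh : ∫ ω, h (U ω) ∂μ = a 0 + ∑ k ∈ Finset.Icc 1 m₁, a k * (1/((k:ℝ)+1)) := by
    simp only [h]
    rw [integral_add (integrable_const _)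
      (integrable_finsetSum _ fun k _ => hfi (fun x => a k * x^k) (by fun_prop)),
      integral_finsetSum _ fun k _ => hfi (fun x => a k * x^k) (by fun_prop)]
    simp only [integral_const_mul, hmean]
    simp
  have hres : (fun ω => Y ω - (μ[Y | 𝓦]) ω) =ᵐ[μ]
      fun ω => (∑ k ∈ Finset.Icc 1 m₁, a k * ((U ω)^k - 1/((k:ℝ)+1))) + ε ω := by
    filter_upwards [hcY] with ω h1
    rw [h1, hY ω, hmh]
    simp only [mul_sub, Finset.sum_sub_distrib]
    ring
  have hmain : ∫ ω, ((∑ k ∈ Finset.Icc 1 m₁, a k * ((U ω)^k - 1/((k:ℝ)+1))) + ε ω)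
      * ((U ω)^l - 1/((l:ℝ)+1)) ∂μ = ∑ k ∈ Finset.Icc 1 m₁, a k * covM k l := by
    have e1 : ∀ ω, ((∑ k ∈ Finset.Icc 1 m₁, a k * ((U ω)^k - 1/((k:ℝ)+1))) + ε ω)
      * ((U ω)^l - 1/((l:ℝ)+1)) = (∑ k ∈ Finset.Icc 1 m₁,
        a k * (((U ω)^k - 1/((k:ℝ)+1)) * ((U ω)^l - 1/((l:ℝ)+1))))
        + ε ω * ((U ω)^l - 1/((l:ℝ)+1)) := by
      intro ω
      rw [add_mul, Finset.sum_mul]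
      simp only [mul_assoc]
    have hI : IndepFun ε (fun ω => (U ω)^l - 1/((l:ℝ)+1)) μ :=
      hεU.comp (φ := id) (ψ := fun x => x^l - 1/((l:ℝ)+1)) measurable_id (by fun_prop)
    have hUi := hfi (fun x => x^l - 1/((l:ℝ)+1)) (by fun_prop)
    have hz : ∫ ω, ε ω * ((U ω)^l - 1/((l:ℝ)+1)) ∂μ = 0 := by
      have := hI.integral_mul_eq_mul_integral hεi.aestronglyMeasurable hUi.aestronglyMeasurable
      rw [hε0, zero_mul] at this
      exact this
    have hεp : Integrable (fun ω => ε ω * ((U ω)^l - 1/((l:ℝ)+1))) μ := hI.integrable_mul hεi hUi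
    simp_rw [e1]
    rw [integral_add (integrable_finsetSum _ fun k _ => hfi (fun x => a k * ((x^k - 1/((k:ℝ)+1)) *
        (x^l - 1/((l:ℝ)+1)))) (by fun_prop)) hεp, hz, add_zero,
      integral_finsetSum _ fun k _ => hfi (fun x => a k * ((x^k - 1/((k:ℝ)+1)) *
        (x^l - 1/((l:ℝ)+1)))) (by fun_prop)]
    refine Finset.sum_congr rfl fun k _ => ?_
    rw [integral_const_mul, hfint (fun x => (x^k - 1/((k:ℝ)+1)) * (x^l - 1/((l:ℝ)+1)))
      (by fun_prop), integral_covM]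
  constructor
  · rw [← hmain]
    refine integral_congr_ae ?_
    filter_upwards [hres] with ω h1
    rw [h1, hmean l]
  · rw [← hmain]
    refine integral_congr_ae ?_
    filter_upwards [hres, hcU (fun x => x^l) (by fun_prop)] with ω h1 h2
    rw [h1, h2, hmean l]

lemma prop2_of_bound (m : ℕ) (bound : ℝ → ℝ)
    (hb : ∀ a : ℕ → ℝ, bound (∑ l ∈ Finset.Icc 1 m, |a l|) ≤
      ∑ l ∈ Finset.Icc 1 m, |∑ k ∈ Finset.Icc 1 m, a k * covM k l|) :
    Prop2Conclusion m bound := by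
  intro Ω _ μ _ p j X hX hmap a _ H hH hHi ε hε hεi hε0 hind Y hY
  have key := kappa_eq μ p j X hX hmap m a H hH hHi ε hε hεi hε0 hind Y hY
  refine le_min ?_ ?_
  · refine (hb a).trans (le_of_eq (Finset.sum_congr rfl fun l _ => ?_))
    rw [(key l).1]
  · refine (hb a).trans (le_of_eq (Finset.sum_congr rfl fun l _ => ?_))
    rw [(key l).2]

/-- **Proposition 2 (signal strength lower bounds for polynomial additive effects).**
For each `m₁ ≥ 1` there is a constant `c_{m₁} > 0`, depending only on `m₁`, such that
`min{Σ_l |κⱼ⁽ˡ⁾|, Σ_l |κ_{j|X₋ⱼ}⁽ˡ⁾|} ≥ (Σ_l |a_l| / m₁) · c_{m₁} > 0`.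
In particular, for `m₁ ∈ {1, 2}`, the minimum is at least `0.001 · Σ_l |a_l|`. -/
theorem stmt_8 (m₁ : ℕ) (hm₁ : 1 ≤ m₁) :
    (∃ c : ℝ, 0 < c ∧ Prop2Conclusion m₁ (fun s => s / m₁ * c)) ∧
      (m₁ ≤ 2 → Prop2Conclusion m₁ (fun s => 0.001 * s)) := by
  refine ⟨?_, fun h2 => prop2_of_bound m₁ _ (covM_small m₁ hm₁ h2)⟩
  obtain ⟨c, hc, hb⟩ := covM_bound m₁ hm₁
  exact ⟨c, hc, prop2_of_bound m₁ _ hb⟩
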